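/- Let g, g' be homeomorphisms acting discontinuously on topological manifolds X, X' respectively, with X/g and X'/g' connected. Let ĥ : X/g → X'/g' be a homeomorphism, let x ∈ X and x' ∈ p'⁻¹(ĥ(p(x))), and assume the following compatibility: for every loop ĉ in X/g based at p(x), if the lift of ĉ starting at x ends at g^k(x), then the lift of ĥ ∘ ĉ starting at x' ends at g'^k(x'). Then there is a unique homeomorphism h : X → X' such that p' ∘ h = ĥ ∘ p, h ∘ g = g' ∘ h, and h(x) = x'. -/

import Mathlib

/-- A homeomorphism `g` of a topological space `X` acts *discontinuously* if for every
compact set `K ⊆ X` the set of integers `k` with `g^k(K) ∩ K ≠ ∅` is finite. -/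
def ActsDiscontinuously {X : Type*} [TopologicalSpace X] (g : X ≃ₜ X) : Prop :=
  ∀ K : Set X, IsCompact K → {k : ℤ | (⇑(g.toEquiv ^ k) '' K ∩ K).Nonempty}.Finite

/-- The orbit relation of the `ℤ`-action generated by `g`. -/
def orbitRelOf {X : Type*} [TopologicalSpace X] (g : X ≃ₜ X) : X → X → Prop :=
  fun x y => ∃ k : ℤ, (g.toEquiv ^ k) x = y

open Topology in
theorem aux_continuous_zpow {X : Type*} [TopologicalSpace X] (g : X ≃ₜ X) (k : ℤ) :
    Continuous (⇑(g.toEquiv ^ k)) := by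
  have hnat : ∀ n : ℕ, Continuous (⇑(g.toEquiv ^ n)) := by
    intro n
    induction n with
    | zero => exact continuous_id
    | succ m ih =>
      rw [pow_succ]
      exact ih.comp g.continuous
  have hnat' : ∀ n : ℕ, Continuous (⇑((g.toEquiv ^ n)⁻¹)) := by
    intro n
    induction n with
    | zero => simpa using continuous_id
    | succ m ih =>
      rw [pow_succ, mul_inv_rev]
      exact g.symm.continuous.comp ih
  cases k with
  | ofNat n => simpa using hnat n
  | negSucc n => simpa [zpow_negSucc] using hnat' (n + 1)

theorem aux_zpow_add {X : Type*} [TopologicalSpace X] (g : X ≃ₜ X) (k l : ℤ) (y : X) :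
    (g.toEquiv ^ k) ((g.toEquiv ^ l) y) = (g.toEquiv ^ (k + l)) y := by
  rw [zpow_add]; rfl

theorem aux_free {X : Type*} [TopologicalSpace X] {g : X ≃ₜ X}
    (hg : ActsDiscontinuously g) {k : ℤ} {y : X} (h : (g.toEquiv ^ k) y = y) : k = 0 := by
  by_contra hk
  have hfin := hg {y} isCompact_singleton
  have hmul : ∀ m : ℤ, (g.toEquiv ^ (k * m)) y = y := by
    intro m
    rw [zpow_mul]
    exact Function.IsFixedPt.perm_zpow (e := g.toEquiv ^ k) h m
  refine Set.infinite_range_of_injective (f := fun m : ℤ => k * m)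
    (fun a b hab => by simpa [hk] using hab) (hfin.subset ?_)
  rintro _ ⟨m, rfl⟩
  exact ⟨y, ⟨y, rfl, hmul m⟩, rfl⟩

theorem aux_free' {X : Type*} [TopologicalSpace X] {g : X ≃ₜ X}
    (hg : ActsDiscontinuously g) {k l : ℤ} {y : X}
    (h : (g.toEquiv ^ k) y = (g.toEquiv ^ l) y) : k = l := by
  have : (g.toEquiv ^ (-l + k)) y = y := by
    rw [← aux_zpow_add, h, aux_zpow_add]; simp
  have := aux_free hg this
  omega

theorem aux_mk_eq {X : Type*} [TopologicalSpace X] (g : X ≃ₜ X) {y z : X} :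
    Quot.mk (orbitRelOf g) y = Quot.mk (orbitRelOf g) z ↔ ∃ k : ℤ, (g.toEquiv ^ k) y = z := by
  have he : Equivalence (orbitRelOf g) :=
    { refl := fun a => ⟨0, by simp⟩
      symm := by
        rintro a b ⟨k, rfl⟩
        exact ⟨-k, by rw [aux_zpow_add]; simp⟩
      trans := by
        rintro a b c ⟨k, rfl⟩ ⟨l, rfl⟩
        exact ⟨l + k, by rw [aux_zpow_add]⟩ }
  rw [Quot.eq, he.eqvGen_iff]
  rfl

theorem aux_mk_zpow {X : Type*} [TopologicalSpace X] (g : X ≃ₜ X) (k : ℤ) (y : X) :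
    Quot.mk (orbitRelOf g) ((g.toEquiv ^ k) y) = Quot.mk (orbitRelOf g) y :=
  ((aux_mk_eq g).2 ⟨k, rfl⟩).symm

theorem aux_covering {X : Type*} [TopologicalSpace X] [T2Space X] [LocallyCompactSpace X]
    {g : X ≃ₜ X} (hg : ActsDiscontinuously g) : IsCoveringMap (Quot.mk (orbitRelOf g)) := by
  let G := Subgroup.zpowers g.toEquiv
  have h1 : ContinuousConstSMul G X := ⟨by
    rintro ⟨_, k, rfl⟩
    exact aux_continuous_zpow g k⟩
  have h2 : ProperlyDiscontinuousSMul G X := ⟨by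
    intro K L hK hL
    refine ((hg (K ∪ L) (hK.union hL)).image
      (fun k : ℤ => (⟨g.toEquiv ^ k, k, rfl⟩ : G))).subset ?_
    rintro ⟨_, k, rfl⟩ ⟨_, ⟨y, hy, rfl⟩, hz⟩
    exact ⟨k, ⟨_, ⟨y, Or.inl hy, rfl⟩, Or.inr hz⟩, rfl⟩⟩
  have h3 : IsCancelSMul G X := by
    rw [isCancelSMul_iff_eq_one_of_smul_eq]
    rintro ⟨_, k, rfl⟩ y hy
    have : k = 0 := aux_free hg hy
    subst this
    ext; simp
  refine (isQuotientMap_quot_mk.isQuotientCoveringMap_of_properlyDiscontinuousSMul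
    (G := G) ?_).isCoveringMap
  intro a b
  rw [eq_comm, aux_mk_eq]
  constructor
  · rintro ⟨k, rfl⟩
    exact ⟨⟨g.toEquiv ^ k, k, rfl⟩, rfl⟩
  · rintro ⟨⟨_, k, rfl⟩, rfl⟩
    exact ⟨k, rfl⟩

/-- The graph of the lift, described by pairs of compatible paths. -/
def LiftRel {X X' : Type*} [TopologicalSpace X] [TopologicalSpace X'] (g : X ≃ₜ X) (g' : X' ≃ₜ X')
    (hhat : Quot (orbitRelOf g) ≃ₜ Quot (orbitRelOf g')) (x : X) (x' : X') (y : X) (y' : X') :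
    Prop :=
  ∃ (k : ℤ) (c : Path x ((g.toEquiv ^ k) y)) (d : Path x' ((g'.toEquiv ^ k) y')),
    ∀ t, Quot.mk (orbitRelOf g') (d t) = hhat (Quot.mk (orbitRelOf g) (c t))

theorem aux_trans {X X' : Type*} [TopologicalSpace X] [TopologicalSpace X'] (P : X → X' → Prop)
    {a b e : X} {a' b' e' : X'} {c : Path a b} {d : Path a' b'} {c₂ : Path b e} {d₂ : Path b' e'}
    (h : ∀ t, P (c t) (d t)) (h₂ : ∀ t, P (c₂ t) (d₂ t)) (t : unitInterval) :
    P (c.trans c₂ t) (d.trans d₂ t) := by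
  rw [Path.trans_apply, Path.trans_apply]
  split_ifs
  · exact h _
  · exact h₂ _

section
variable {X X' : Type*} [TopologicalSpace X] [TopologicalSpace X'] {g : X ≃ₜ X} {g' : X' ≃ₜ X'}
  {hhat : Quot (orbitRelOf g) ≃ₜ Quot (orbitRelOf g')} {x : X} {x' : X'}

theorem LiftRel.symm {y : X} {y' : X'} (h : LiftRel g g' hhat x x' y y') :
    LiftRel g' g hhat.symm x' x y' y := by
  obtain ⟨k, c, d, h⟩ := h
  exact ⟨k, d, c, fun t => by rw [h t]; simp⟩

theorem LiftRel.proj {y : X} {y' : X'} (h : LiftRel g g' hhat x x' y y') :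
    Quot.mk (orbitRelOf g') y' = hhat (Quot.mk (orbitRelOf g) y) := by
  obtain ⟨k, c, d, h⟩ := h
  simpa [aux_mk_zpow] using h 1

theorem LiftRel.step {y : X} {y' : X'} (h : LiftRel g g' hhat x x' y y') :
    LiftRel g g' hhat x x' (g y) (g' y') := by
  obtain ⟨k, c, d, h⟩ := h
  refine ⟨k - 1, c.cast rfl ?_, d.cast rfl ?_, h⟩
  · have := aux_zpow_add g (k - 1) 1 y
    simpa using this
  · have := aux_zpow_add g' (k - 1) 1 y'
    simpa using this

theorem LiftRel.base (hx' : Quot.mk (orbitRelOf g') x' = hhat (Quot.mk (orbitRelOf g) x)) :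
    LiftRel g g' hhat x x' x x' :=
  ⟨0, (Path.refl x).cast rfl (by simp), (Path.refl x').cast rfl (by simp), fun t => by
    simpa using hx'⟩

theorem aux_exists_path [LocallyPathConnectedSpace X] [ConnectedSpace (Quot (orbitRelOf g))]
    (cov : IsCoveringMap (Quot.mk (orbitRelOf g))) (x y : X) :
    ∃ k : ℤ, Nonempty (Path x ((g.toEquiv ^ k) y)) := by
  have : PathConnectedSpace (Quot (orbitRelOf g)) := .of_locallyPathConnectedSpace
  obtain ⟨γ⟩ := PathConnectedSpace.joined (Quot.mk (orbitRelOf g) x) (Quot.mk (orbitRelOf g) y)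
  obtain ⟨Γ, hΓ, h0⟩ := cov.exists_path_lifts γ.toContinuousMap x (by simp)
  have h1 : Quot.mk (orbitRelOf g) y = Quot.mk (orbitRelOf g) (Γ 1) := by
    have := congr_fun hΓ 1
    simpa using this.symm
  obtain ⟨k, hk⟩ := (aux_mk_eq g).1 h1
  exact ⟨k, ⟨⟨Γ, h0, hk.symm⟩⟩⟩

theorem LiftRel.total [LocallyPathConnectedSpace X] [ConnectedSpace (Quot (orbitRelOf g))]
    (cov : IsCoveringMap (Quot.mk (orbitRelOf g))) (cov' : IsCoveringMap (Quot.mk (orbitRelOf g')))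
    (hx' : Quot.mk (orbitRelOf g') x' = hhat (Quot.mk (orbitRelOf g) x)) (y : X) :
    ∃ y', LiftRel g g' hhat x x' y y' := by
  obtain ⟨k, ⟨c⟩⟩ := aux_exists_path cov x y
  obtain ⟨Γ, hΓ, h0⟩ := cov'.exists_path_lifts
    ((c.map cov.continuous).map hhat.continuous).toContinuousMap x' (by simpa using hx'.symm)
  refine ⟨(g'.toEquiv ^ (-k)) (Γ 1), k, c, ⟨Γ, h0, ?_⟩, fun t => congr_fun hΓ t⟩
  rw [aux_zpow_add]; simp

theorem LiftRel.functional (hg' : ActsDiscontinuously g')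
    (hcompat : ∀ (c : C(unitInterval, X)) (k : ℤ),
      c 0 = x → c 1 = (g.toEquiv ^ k) x →
      ∀ d : C(unitInterval, X'), d 0 = x' →
        (∀ t, Quot.mk (orbitRelOf g') (d t) = hhat (Quot.mk (orbitRelOf g) (c t))) →
        d 1 = (g'.toEquiv ^ k) x') {y : X} {y₁ y₂ : X'}
    (h₁ : LiftRel g g' hhat x x' y y₁) (h₂ : LiftRel g g' hhat x x' y y₂) : y₁ = y₂ := by
  obtain ⟨j, hj⟩ := (aux_mk_eq g').1 (h₂.proj.trans h₁.proj.symm)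
  obtain ⟨k, c, d, h⟩ := h₁
  obtain ⟨l, c₂, d₂, h₂⟩ := h₂
  have e1 : (g.toEquiv ^ k) y = (g.toEquiv ^ (k - l)) ((g.toEquiv ^ l) y) := by
    rw [aux_zpow_add]; simp
  have e2 : (g'.toEquiv ^ k) y₁ = (g'.toEquiv ^ (k + j - l)) ((g'.toEquiv ^ l) y₂) := by
    rw [aux_zpow_add, ← hj, aux_zpow_add]; simp
  let c₃ := (c₂.map (aux_continuous_zpow g (k - l))).symm.cast e1 rfl
  let d₃ := (d₂.map (aux_continuous_zpow g' (k + j - l))).symm.cast e2 rfl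
  have key := hcompat (c.trans c₃).toContinuousMap (k - l) (c.trans c₃).source (c.trans c₃).target
    (d.trans d₃).toContinuousMap (d.trans d₃).source
    (aux_trans (fun a b => Quot.mk (orbitRelOf g') b = hhat (Quot.mk (orbitRelOf g) a)) h
      (fun t => by simp [c₃, d₃, Path.symm_apply, aux_mk_zpow, h₂]))
  have key2 : (g'.toEquiv ^ (k + j - l)) x' = (g'.toEquiv ^ (k - l)) x' :=
    (d.trans d₃).target.symm.trans key
  have := aux_free' hg' key2
  have hj0 : j = 0 := by omega
  subst hj0
  simpa using hj.symm

theorem LiftRel.of_lift [LocallyPathConnectedSpace X] [ConnectedSpace (Quot (orbitRelOf g))]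
    (cov : IsCoveringMap (Quot.mk (orbitRelOf g))) (f : X → X') (hf : Continuous f)
    (h1 : ∀ y, Quot.mk (orbitRelOf g') (f y) = hhat (Quot.mk (orbitRelOf g) y))
    (h2 : ∀ y, f (g y) = g' (f y)) (h3 : f x = x') (y : X) :
    LiftRel g g' hhat x x' y (f y) := by
  obtain ⟨k, ⟨c⟩⟩ := aux_exists_path cov x y
  have h4 : ∀ (k : ℤ) y, f ((g.toEquiv ^ k) y) = (g'.toEquiv ^ k) (f y) := by
    intro k
    induction k with
    | zero => intro y; rfl
    | succ i ih =>
      intro y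
      rw [← aux_zpow_add, ← aux_zpow_add, ih]
      simp [h2]
    | pred i ih =>
      intro y
      have e1 := aux_zpow_add g (-(i : ℤ) - 1) 1 (g.symm y)
      have e2 := aux_zpow_add g' (-(i : ℤ) - 1) 1 (f (g.symm y))
      have e3 := ih (g.symm y)
      have e4 := h2 (g.symm y)
      simp only [zpow_one, sub_add_cancel, Homeomorph.coe_toEquiv, Homeomorph.apply_symm_apply]
        at e1 e2 e3 e4
      rw [e1, e3, ← e2, ← e4]
  exact ⟨k, c, (c.map hf).cast h3.symm (h4 k y).symm, fun t => h1 _⟩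

theorem LiftRel.continuous [LocallyPathConnectedSpace X]
    (cov : IsCoveringMap (Quot.mk (orbitRelOf g))) (cov' : IsCoveringMap (Quot.mk (orbitRelOf g')))
    (f : X → X') (hf : ∀ y y', LiftRel g g' hhat x x' y y' ↔ f y = y') : Continuous f := by
  rw [continuous_iff_continuousAt]
  intro y₀
  have hR := (hf y₀ _).2 rfl
  obtain ⟨e, he, hpe⟩ := cov'.isLocalHomeomorph (f y₀)
  let q : X → Quot (orbitRelOf g') := fun y => hhat (Quot.mk (orbitRelOf g) y)
  have hq : Continuous q := hhat.continuous.comp cov.continuous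
  have hq0 : q y₀ = e (f y₀) := by rw [← hpe]; exact hR.proj.symm
  have hy0 : q y₀ ∈ e.target := by rw [hq0]; exact e.map_source he
  have hN : IsOpen (q ⁻¹' e.target) := e.open_target.preimage hq
  have hs0 : e.symm (q y₀) = f y₀ := by rw [hq0]; exact e.left_inv he
  have hcs : ContinuousOn (fun y => e.symm (q y)) (q ⁻¹' e.target) :=
    e.continuousOn_symm.comp hq.continuousOn (fun _ h => h)
  have hev : f =ᶠ[nhds y₀] fun y => e.symm (q y) := by
    filter_upwards [pathComponentIn_mem_nhds (hN.mem_nhds hy0)] with y hy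
    obtain ⟨γ, hγ⟩ := hy
    obtain ⟨k, c, d, h⟩ := hR
    rw [← hf]
    let γ' := (γ.map' (f := fun y => e.symm (q y)) (hcs.mono (by
      rintro _ ⟨t, rfl⟩; exact hγ t))).cast hs0.symm rfl
    refine ⟨k, c.trans (γ.map (aux_continuous_zpow g k)),
      d.trans (γ'.map (aux_continuous_zpow g' k)),
      aux_trans (fun a b => Quot.mk (orbitRelOf g') b = hhat (Quot.mk (orbitRelOf g) a)) h
        (fun t => ?_)⟩
    have h5 : Quot.mk (orbitRelOf g') (e.symm (q (γ t))) = q (γ t) := by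
      rw [hpe]; exact e.right_inv (hγ t)
    simp only [Path.map_coe, Function.comp_apply, aux_mk_zpow]
    exact h5
  exact (hcs.continuousAt (hN.mem_nhds hy0)).congr hev.symm

end

/-- Let `g, g'` act discontinuously on topological manifolds `X, X'` with
connected orbit spaces, let `hhat : X/g → X'/g'` be a homeomorphism, let `x ∈ X` and
`x' ∈ p'⁻¹(hhat (p x))`, and assume the compatibility: for every loop `ĉ` based at `p x`,
if the lift of `ĉ` starting at `x` ends at `g^k(x)`, then the lift of `hhat ∘ ĉ` starting
at `x'` ends at `g'^k(x')`.  Then there is a unique homeomorphism `h : X → X'` with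
`p' ∘ h = hhat ∘ p`, `h ∘ g = g' ∘ h` and `h x = x'`. -/
theorem lift_of_orbit_space_homeomorphism {n n' : ℕ} {X X' : Type*}
    [TopologicalSpace X] [T2Space X] [ChartedSpace (EuclideanSpace ℝ (Fin n)) X]
    [TopologicalSpace X'] [T2Space X'] [ChartedSpace (EuclideanSpace ℝ (Fin n')) X']
    (g : X ≃ₜ X) (g' : X' ≃ₜ X')
    (hg : ActsDiscontinuously g) (hg' : ActsDiscontinuously g')
    (hc : ConnectedSpace (Quot (orbitRelOf g)))
    (hc' : ConnectedSpace (Quot (orbitRelOf g')))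
    (hhat : Quot (orbitRelOf g) ≃ₜ Quot (orbitRelOf g'))
    (x : X) (x' : X') (hx' : Quot.mk (orbitRelOf g') x' = hhat (Quot.mk (orbitRelOf g) x))
    (hcompat : ∀ (c : C(unitInterval, X)) (k : ℤ),
      c 0 = x → c 1 = (g.toEquiv ^ k) x →
      ∀ d : C(unitInterval, X'), d 0 = x' →
        (∀ t, Quot.mk (orbitRelOf g') (d t) = hhat (Quot.mk (orbitRelOf g) (c t))) →
        d 1 = (g'.toEquiv ^ k) x') :
    ∃! h : X ≃ₜ X',
      (∀ y, Quot.mk (orbitRelOf g') (h y) = hhat (Quot.mk (orbitRelOf g) y)) ∧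
      (∀ y, h (g y) = g' (h y)) ∧ h x = x' := by
  have : LocallyCompactSpace X := ChartedSpace.locallyCompactSpace (EuclideanSpace ℝ (Fin n)) X
  have : LocallyCompactSpace X' := ChartedSpace.locallyCompactSpace (EuclideanSpace ℝ (Fin n')) X'
  have : LocallyPathConnectedSpace X :=
    ChartedSpace.locallyPathConnectedSpace (EuclideanSpace ℝ (Fin n)) X
  have : LocallyPathConnectedSpace X' :=
    ChartedSpace.locallyPathConnectedSpace (EuclideanSpace ℝ (Fin n')) X'
  have cov := aux_covering hg
  have cov' := aux_covering hg'
  have hx : Quot.mk (orbitRelOf g) x = hhat.symm (Quot.mk (orbitRelOf g') x') := by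
    rw [hx']; simp
  have hcompat' : ∀ (d : C(unitInterval, X')) (k : ℤ),
      d 0 = x' → d 1 = (g'.toEquiv ^ k) x' →
      ∀ c : C(unitInterval, X), c 0 = x →
        (∀ t, Quot.mk (orbitRelOf g) (c t) = hhat.symm (Quot.mk (orbitRelOf g') (d t))) →
        c 1 = (g.toEquiv ^ k) x := by
    intro d k d0 d1 c c0 h
    have h1 : Quot.mk (orbitRelOf g) x = Quot.mk (orbitRelOf g) (c 1) := by
      rw [h 1, d1, aux_mk_zpow, hx]
    obtain ⟨m, hm⟩ := (aux_mk_eq g).1 h1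
    have h2 := hcompat c m c0 hm.symm d d0 (fun t => by rw [h t]; simp)
    have h3 : k = m := aux_free' hg' (d1.symm.trans h2)
    rw [h3, hm]
  choose f hf using LiftRel.total (x := x) (x' := x') cov cov' hx'
  choose f' hf' using LiftRel.total (x := x') (x' := x) cov' cov hx
  have F : ∀ y y', LiftRel g g' hhat x x' y y' ↔ f y = y' := fun y y' =>
    ⟨fun h => LiftRel.functional hg' hcompat (hf y) h, fun h => h ▸ hf y⟩
  have F' : ∀ y y', LiftRel g' g hhat.symm x' x y y' ↔ f' y = y' := fun y y' =>
    ⟨fun h => LiftRel.functional hg hcompat' (hf' y) h, fun h => h ▸ hf' y⟩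
  let h : X ≃ₜ X' :=
    { toFun := f
      invFun := f'
      left_inv := fun y => (F' _ _).1 (hf y).symm
      right_inv := fun y => (F _ _).1 (by simpa using (hf' y).symm)
      continuous_toFun := LiftRel.continuous cov cov' f F
      continuous_invFun := LiftRel.continuous cov' cov f' F' }
  refine ⟨h, ⟨fun y => (hf y).proj, fun y => (F _ _).1 (hf y).step,
    (F _ _).1 (LiftRel.base hx')⟩, ?_⟩
  rintro h₂ ⟨a, b, c⟩
  ext y
  exact ((F _ _).1 (LiftRel.of_lift cov h₂ h₂.continuous a b c y)).symm
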